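/- arXiv:1602.00998 — 6 statements merged into one kernel-verified Lean document; each statement's English description precedes it below -/
import Mathlib

section
/- Let W be a finite nonempty set, let f : P*(W) → {0,1} be a minimizing function, and let Υ be the set of all atoms of f. Then for every nonempty subset X of W, f(X) = 1 if and only if there exists ω ∈ Υ with ω ⊆ X. -/
/-- An atom of a zero-one valued function `f` on subsets of `W`: a nonempty set `ω` with
`f ω = 1` and `f η = 0` for every nonempty proper subset `η` of `ω`. -/
def MinAtom {W : Type*} (f : Set W → Bool) (ω : Set W) : Prop :=
  ω.Nonempty ∧ f ω = true ∧ ∀ η : Set W, η.Nonempty → η ⊂ ω → f η = false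

/-- For a minimizing function `f` and nonempty `X ⊆ W`, `f X = 1` iff
some atom of `f` is contained in `X`. -/
theorem value_one_iff_contains_atom {W : Type*} [Fintype W] [Nonempty W]
    (f : Set W → Bool)
    (hmin : ∀ A B : Set W, A.Nonempty → B.Nonempty → (A ∩ B).Nonempty →
      f (A ∩ B) = (f A && f B))
    (X : Set W) (hX : X.Nonempty) :
    f X = true ↔ ∃ ω : Set W, MinAtom f ω ∧ ω ⊆ X := by
  constructor
  · intro h
    induction X using (wellFounded_lt (α := Set W)).induction with
    | _ X ih =>
      by_cases hA : ∀ η : Set W, η.Nonempty → η ⊂ X → f η = false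
      · exact ⟨X, ⟨hX, h, hA⟩, subset_rfl⟩
      · push Not at hA
        obtain ⟨η, hne, hs, hf⟩ := hA
        obtain ⟨ω, hω, hsub⟩ := ih η hs hne (by simpa using hf)
        exact ⟨ω, hω, hsub.trans hs.subset⟩
  · rintro ⟨ω, ⟨hne, hf, -⟩, hsub⟩
    have hi : ω ∩ X = ω := Set.inter_eq_left.mpr hsub
    have h := hmin ω X hne hX (by rw [hi]; exact hne)
    rw [hi, hf] at h
    simpa using h.symm
end

section
/- Let W be a finite nonempty set and let f : P*(W) → {0,1} be a minimizing function that has at least two distinct atoms. Then for every x ∈ W, the singleton {x} is an atom of f. -/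
/-- If a minimizing function `f` has at least two distinct atoms, then every
singleton `{x}` (for `x ∈ W`) is an atom of `f`. -/
theorem two_atoms_imp_all_singletons_atoms {W : Type*} [Fintype W] [Nonempty W]
    (f : Set W → Bool)
    (hmin : ∀ A B : Set W, A.Nonempty → B.Nonempty → (A ∩ B).Nonempty →
      f (A ∩ B) = (f A && f B))
    (htwo : ∃ ω₁ ω₂ : Set W, MinAtom f ω₁ ∧ MinAtom f ω₂ ∧ ω₁ ≠ ω₂) :
    ∀ x : W, MinAtom f {x} := by
  obtain ⟨A, B, ⟨hA, fA, mA⟩, ⟨hB, fB, mB⟩, hne⟩ := htwo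
  have mono : ∀ S T : Set W, S.Nonempty → S ⊆ T → f S = true → f T = true := by
    intro S T hS hST h
    have hi : S ∩ T = S := Set.inter_eq_left.mpr hST
    have h2 := hmin S T hS (hS.mono hST) (by rw [hi]; exact hS)
    rw [hi, h] at h2
    simpa using h2.symm
  have hdis : ¬ (A ∩ B).Nonempty := by
    intro hn
    have h1 : f (A ∩ B) = true := by rw [hmin A B hA hB hn, fA, fB]; rfl
    have e1 : A ∩ B = A := by
      by_contra hc
      have := mA _ hn (Set.inter_subset_left.ssubset_of_ne hc)
      simp [h1] at this
    have e2 : A ∩ B = B := by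
      by_contra hc
      have := mB _ hn (Set.inter_subset_right.ssubset_of_ne hc)
      simp [h1] at this
    exact hne (e1.symm.trans e2)
  intro x
  have hx : (A ∪ {x}) ∩ (B ∪ {x}) = {x} := by
    rw [← Set.inter_union_distrib_right, Set.not_nonempty_iff_eq_empty.mp hdis,
      Set.empty_union]
  refine ⟨Set.singleton_nonempty x, ?_, ?_⟩
  · have h := hmin (A ∪ {x}) (B ∪ {x}) (hA.mono Set.subset_union_left)
      (hB.mono Set.subset_union_left) (by rw [hx]; exact Set.singleton_nonempty x)
    rw [hx, mono A _ hA Set.subset_union_left fA, mono B _ hB Set.subset_union_left fB] at h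
    simpa using h
  · intro η hη hs
    exact absurd (Set.ssubset_singleton_iff.mp hs) hη.ne_empty
end

section
/- Let G=(U,W,T,S) be an S_MC-approximation and define τ = { Ḡ(A) : A ⊆ W }. Then (U, τ) is a topology on U: τ contains ∅ and U, and τ is closed under arbitrary unions and under finite intersections. -/
/-- For an S_MC-approximation G=(U,W,T,S), the family
τ = { Ḡ(A) : A ⊆ W } is a topology on U: it contains ∅ and U, and is closed under
arbitrary unions and finite intersections. -/
theorem smc_upper_forms_topology {U W : Type*}
    [Fintype U] [Fintype W] [Nonempty U] [Nonempty W]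
    (T : U → Set W) (hT : ∀ x, (T x).Nonempty)
    (S : Set W → Set W → Bool)
    (hmin : ∀ A B C : Set W, A.Nonempty → S A (B ∩ C) = (S A B && S A C))
    (hcomp : ∀ A B : Set W, A.Nonempty → S A Bᶜ = !(S A B))
    (hempty : ∀ A : Set W, A.Nonempty → S A ∅ = false)
    (τ : Set (Set U))
    (hτ : τ = {Y : Set U | ∃ A : Set W, Y = {x : U | S (T x) Aᶜ = false}}) :
    (∅ : Set U) ∈ τ ∧ (Set.univ : Set U) ∈ τ ∧
      (∀ 𝒮 : Set (Set U), 𝒮 ⊆ τ → ⋃₀ 𝒮 ∈ τ) ∧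
      (∀ (k : ℕ) (Y : Fin k → Set U), (∀ i, Y i ∈ τ) → (⋂ i, Y i) ∈ τ) := by
  have hm : ∀ Y : Set U, Y ∈ τ ↔ ∃ A : Set W, ∀ x, x ∈ Y ↔ S (T x) A = true := by
    intro Y
    rw [hτ]
    constructor
    · rintro ⟨A, rfl⟩
      refine ⟨A, fun x => ?_⟩
      simp [hcomp _ A (hT x)]
    · rintro ⟨A, hA⟩
      refine ⟨A, ?_⟩
      ext x
      simp [hcomp _ A (hT x), hA x]
  have h0 : (∅ : Set U) ∈ τ := (hm _).2 ⟨∅, fun x => by simp [hempty _ (hT x)]⟩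
  have h1 : (Set.univ : Set U) ∈ τ :=
    (hm _).2 ⟨∅ᶜ, fun x => by rw [hcomp _ _ (hT x)]; simp [hempty _ (hT x)]⟩
  have hI : ∀ X Y : Set U, X ∈ τ → Y ∈ τ → X ∩ Y ∈ τ := by
    intro X Y hX hY
    obtain ⟨A, hA⟩ := (hm _).1 hX
    obtain ⟨B, hB⟩ := (hm _).1 hY
    exact (hm _).2 ⟨A ∩ B, fun x => by simp [hmin _ _ _ (hT x), hA x, hB x]⟩
  have hU : ∀ X Y : Set U, X ∈ τ → Y ∈ τ → X ∪ Y ∈ τ := by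
    intro X Y hX hY
    obtain ⟨A, hA⟩ := (hm _).1 hX
    obtain ⟨B, hB⟩ := (hm _).1 hY
    refine (hm _).2 ⟨(Aᶜ ∩ Bᶜ)ᶜ, fun x => ?_⟩
    rw [hcomp _ _ (hT x), hmin _ _ _ (hT x), hcomp _ _ (hT x), hcomp _ _ (hT x),
      Set.mem_union, hA x, hB x]
    simp
  refine ⟨h0, h1, ?_, ?_⟩
  · intro 𝒮 h𝒮
    have hf : 𝒮.Finite := Set.toFinite 𝒮
    induction 𝒮, hf using Set.Finite.induction_on with
    | empty => simpa using h0
    | insert _ _ ih =>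
      rw [Set.sUnion_insert]
      exact hU _ _ (h𝒮 (Set.mem_insert _ _)) (ih ((Set.subset_insert _ _).trans h𝒮))
  · intro k
    induction k with
    | zero => intro Y _; simpa using h1
    | succ n ih =>
      intro Y hY
      have : (⋂ i, Y i) = Y 0 ∩ ⋂ i : Fin n, Y i.succ := by
        ext x
        simp [Fin.forall_fin_succ]
      rw [this]
      exact hI _ _ (hY 0) (ih _ fun i => hY _)
end

section
/- Let U and W be fixed finite nonempty sets and T : U → P*(W) a fixed map. Then the number of functions S : P*(W) × P(W) → {0,1} such that G=(U,W,T,S) is an S_MC-approximation (i.e., for every nonempty A ⊆ W and all B, C ⊆ W: S(A, B ∩ C) = min{S(A,B), S(A,C)}, S(A, Bᶜ) = 1 − S(A,B), and S(A, ∅) = 0) equals |W|^(2^{|W|} − 1). -/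
theorem smc_aux {W : Type*} [Fintype W] (s : Set W → Bool)
    (h1 : ∀ B C : Set W, s (B ∩ C) = (s B && s C))
    (h2 : ∀ B : Set W, s Bᶜ = !(s B)) (h3 : s ∅ = false) :
    ∃ w, ∀ B, s B = true ↔ w ∈ B := by
  classical
  have hex : ∃ w, s {w} = true := by
    by_contra hne
    push Not at hne
    have key : ∀ F : Finset W, s ((F : Set W)ᶜ) = true := by
      intro F
      induction F using Finset.induction_on with
      | empty => rw [h2]; simp [h3]
      | insert a F ha ih =>
        have e : ((insert a F : Finset W) : Set W)ᶜ = {a}ᶜ ∩ (F : Set W)ᶜ := by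
          ext x; simp
        rw [e, h1, ih, h2]
        simpa using hne a
    have := key Finset.univ
    simp [h3] at this
  obtain ⟨w, hw⟩ := hex
  refine ⟨w, fun B => ?_⟩
  have hb := h1 {w} B
  by_cases h : w ∈ B
  · have e : ({w} : Set W) ∩ B = {w} := by simpa using h
    rw [e, hw] at hb
    cases hs : s B <;> simp [hs, h] at hb ⊢
  · have e : ({w} : Set W) ∩ B = ∅ := by simpa using h
    rw [e, hw, h3] at hb
    cases hs : s B <;> simp [hs, h] at hb ⊢

/-- With U, W and T : U → P*(W) fixed, the number of functions
S : P*(W) × P(W) → {0,1} making G=(U,W,T,S) an S_MC-approximation equals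
|W|^(2^|W| − 1). -/
theorem card_smc_S_functions {U W : Type*} [Fintype U] [Fintype W] [Nonempty U] [Nonempty W]
    (T : U → Set W) (hT : ∀ x, (T x).Nonempty) :
    Nat.card {S : {A : Set W // A.Nonempty} → Set W → Bool //
        ∀ A : {A : Set W // A.Nonempty},
          (∀ B C : Set W, S A (B ∩ C) = (S A B && S A C)) ∧
          (∀ B : Set W, S A Bᶜ = !(S A B)) ∧
          S A ∅ = false} =
      Fintype.card W ^ (2 ^ Fintype.card W - 1) := by
  classical
  let Φ : ({A : Set W // A.Nonempty} → W) → {S : {A : Set W // A.Nonempty} → Set W → Bool //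
        ∀ A : {A : Set W // A.Nonempty},
          (∀ B C : Set W, S A (B ∩ C) = (S A B && S A C)) ∧
          (∀ B : Set W, S A Bᶜ = !(S A B)) ∧
          S A ∅ = false} := fun f => ⟨fun A B => decide (f A ∈ B), fun A => by simp⟩
  have hΦ : Function.Bijective Φ := by
    constructor
    · intro f g h
      funext A
      have h' := congrFun (congrFun (congrArg Subtype.val h) A) {g A}
      simpa [Φ] using h'
    · rintro ⟨S, hS⟩
      choose f hf using fun A => smc_aux (S A) (hS A).1 (hS A).2.1 (hS A).2.2
      refine ⟨f, Subtype.ext ?_⟩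
      funext A B
      rw [Bool.eq_iff_iff, hf]
      simp [Φ]
  rw [← Nat.card_congr (Equiv.ofBijective Φ hΦ), Nat.card_fun, Nat.card_eq_fintype_card (α := W)]
  congr 1
  have e : {A : Set W // A.Nonempty} ≃ {A : Set W // A ≠ ∅} :=
    Equiv.subtypeEquivRight fun A => Set.nonempty_iff_ne_empty
  rw [Nat.card_congr e, Nat.card_eq_fintype_card, Fintype.card_subtype_compl (fun A : Set W => A = ∅)]
  simp
end

section
/- Let G=(U,W,T,S) and G'=(U',W',T',S') be two S_MC-approximations with |U| = |U'| and |W| = |W'|, and let τ = { Ḡ(A) : A ⊆ W } and τ' = { Ḡ'(A') : A' ⊆ W' } be their associated topologies. Then (U, τ) and (U', τ') are homeomorphic (i.e., there exists a bijection Φ : U → U' such that for every Y ⊆ U, Y ∈ τ if and only if Φ(Y) ∈ τ') if and only if |W_i| = |W'_i| for every non-negative integer i, where W_i = {w ∈ W : deg_G(w) = i} and W'_i = {w' ∈ W' : deg_{G'}(w') = i}. -/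
theorem smc_point {W : Type*} [Fintype W] (f : Set W → Bool)
    (hmin : ∀ B C : Set W, f (B ∩ C) = (f B && f C))
    (hcomp : ∀ B : Set W, f Bᶜ = !(f B))
    (hempty : f ∅ = false) : ∃ w, ∀ B, f B = true ↔ w ∈ B := by
  have huniv : f Set.univ = true := by
    have := hcomp ∅
    rw [Set.compl_empty, hempty] at this
    simpa using this
  have key : ∃ w, f {w} = true := by
    by_contra hne
    push Not at hne
    have hc : ∀ w, f ({w}ᶜ) = true := by
      intro w
      rw [hcomp]
      simpa using hne w
    have : ∀ s : Finset W, f ((s : Set W)ᶜ) = true := by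
      classical
      intro s
      induction s using Finset.induction_on with
      | empty => simpa using huniv
      | insert a s ha ih =>
        rw [Finset.coe_insert, Set.insert_eq, Set.compl_union, hmin, hc, ih]; rfl
    have h := this Finset.univ
    rw [Finset.coe_univ, Set.compl_univ, hempty] at h
    cases h
  obtain ⟨w, hw⟩ := key
  have mono : ∀ B, w ∈ B → f B = true := by
    intro B hB
    have h := hmin {w} B
    rw [Set.inter_eq_left.2 (by simpa using hB), hw] at h
    simpa using h.symm
  refine ⟨w, fun B => ⟨fun h => ?_, mono B⟩⟩
  by_contra hB
  have h2 := mono Bᶜ hB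
  rw [hcomp, h] at h2
  cases h2

theorem smc_atom {W : Type*} (f : Set W → Bool) (p : W)
    (hp : ∀ B, f B = true ↔ p ∈ B) (w : W) : MinAtom f {w} ↔ p = w := by
  constructor
  · rintro ⟨-, h, -⟩
    exact (hp _).1 h
  · rintro rfl
    refine ⟨⟨p, rfl⟩, (hp _).2 rfl, fun η hη hs => ?_⟩
    exact absurd (Set.ssubset_singleton_iff.1 hs) hη.ne_empty

theorem smc_core1 {U W U' W' : Type*} [Finite U] [Fintype W] [Finite U'] [Fintype W']
    (hW : Fintype.card W = Fintype.card W') [Nonempty W']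
    (p : U → W) (p' : U' → W') (Φ : U ≃ U')
    (h : ∀ Y : Set U, (∃ A : Set W, Y = p ⁻¹' A) ↔ ∃ A' : Set W', Φ '' Y = p' ⁻¹' A') :
    ∃ e : W ≃ W', ∀ x, p' (Φ x) = e (p x) := by
  classical
  have h1 : ∀ x y, p x = p y → p' (Φ x) = p' (Φ y) := by
    intro x y hxy
    obtain ⟨A, hA⟩ := (h (Φ ⁻¹' (p' ⁻¹' {p' (Φ x)}))).2
      ⟨{p' (Φ x)}, by rw [Set.image_preimage_eq _ Φ.surjective]⟩
    have hx : x ∈ Φ ⁻¹' (p' ⁻¹' {p' (Φ x)}) := rfl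
    rw [hA] at hx
    have hy : y ∈ p ⁻¹' A := by
      rw [Set.mem_preimage, ← hxy]; exact hx
    rw [← hA] at hy
    exact hy.symm
  have h2 : ∀ x y, p' (Φ x) = p' (Φ y) → p x = p y := by
    intro x y hxy
    obtain ⟨A, hA⟩ := (h (p ⁻¹' {p x})).1 ⟨_, rfl⟩
    have hx : Φ x ∈ Φ '' (p ⁻¹' {p x}) := ⟨x, rfl, rfl⟩
    rw [hA] at hx
    have hy : Φ y ∈ p' ⁻¹' A := by
      rw [Set.mem_preimage, ← hxy]; exact hx
    rw [← hA] at hy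
    obtain ⟨z, hz, hzy⟩ := hy
    rw [Φ.injective hzy] at hz
    exact hz.symm
  let g : W → W' := fun w => if hw : ∃ x, p x = w then p' (Φ hw.choose) else Classical.arbitrary W'
  have hg : ∀ x, g (p x) = p' (Φ x) := by
    intro x
    have hw : ∃ y, p y = p x := ⟨x, rfl⟩
    simp only [g, dif_pos hw]
    exact h1 _ _ hw.choose_spec
  obtain ⟨e, he⟩ := Finset.exists_equiv_extend_of_card_eq (α := W) (t := (Finset.univ : Finset W'))
    (by simpa using hW) (s := Set.univ.image p |>.toFinset) (f := g) (by simp) (by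
      intro a ha b hb hab
      simp at ha hb
      obtain ⟨x, rfl⟩ := ha
      obtain ⟨y, rfl⟩ := hb
      rw [hg, hg] at hab
      exact h2 _ _ hab)
  refine ⟨e.trans (Equiv.subtypeUnivEquiv (by simp)), fun x => ?_⟩
  rw [← hg]
  exact (he (p x) (by simp)).symm

theorem smc_core2 {U W U' W' : Type*} [Finite U] [Finite W] [Finite U'] [Finite W']
    (p : U → W) (p' : U' → W')
    (h : ∀ i : ℕ, Set.ncard {w : W | Set.ncard {u | p u = w} = i} =
      Set.ncard {w : W' | Set.ncard {u | p' u = w} = i}) :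
    ∃ (Φ : U ≃ U') (e : W ≃ W'), ∀ x, p' (Φ x) = e (p x) := by
  have a : ∀ i : ℕ, Nonempty ({w : W // Set.ncard {u | p u = w} = i} ≃
      {w : W' // Set.ncard {u | p' u = w} = i}) := fun i =>
    Finite.card_eq.1 (h i)
  let e : W ≃ W' := Equiv.ofFiberEquiv (fun i => (a i).some)
  have he : ∀ w, Set.ncard {u | p' u = e w} = Set.ncard {u | p u = w} := fun w =>
    Equiv.ofFiberEquiv_map (fun i => (a i).some) w
  have b : ∀ w' : W', Nonempty ({u : U // e (p u) = w'} ≃ {u : U' // p' u = w'}) := by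
    intro w'
    obtain ⟨w, rfl⟩ := e.surjective w'
    have := he w
    refine Finite.card_eq.1 ?_
    simp only [EmbeddingLike.apply_eq_iff_eq]
    exact this.symm
  exact ⟨Equiv.ofFiberEquiv (f := fun u => e (p u)) (fun i => (b i).some), e,
    fun x => Equiv.ofFiberEquiv_map (f := fun u => e (p u)) (fun i => (b i).some) x⟩

theorem smc_core {U W U' W' : Type*} [Finite U] [Fintype W] [Finite U'] [Fintype W']
    (hW : Fintype.card W = Fintype.card W') [Nonempty W']
    (p : U → W) (p' : U' → W') :
    (∃ Φ : U ≃ U', ∀ Y : Set U,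
      (∃ A : Set W, Y = p ⁻¹' A) ↔ ∃ A' : Set W', Φ '' Y = p' ⁻¹' A') ↔
    ∀ i : ℕ, Set.ncard {w : W | Set.ncard {u | p u = w} = i} =
      Set.ncard {w : W' | Set.ncard {u | p' u = w} = i} := by
  constructor
  · rintro ⟨Φ, h⟩ i
    obtain ⟨e, he⟩ := smc_core1 hW p p' Φ h
    have hd : ∀ w, Set.ncard {u | p' u = e w} = Set.ncard {u | p u = w} := by
      intro w
      refine (Nat.card_congr (Φ.subtypeEquiv fun u => ?_)).symm
      simp [he]
    refine Nat.card_congr (e.subtypeEquiv fun w => ?_)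
    simp [hd]
  · intro h
    obtain ⟨Φ, e, he⟩ := smc_core2 p p' h
    refine ⟨Φ, fun Y => ⟨?_, ?_⟩⟩
    · rintro ⟨A, rfl⟩
      refine ⟨e '' A, ?_⟩
      ext y
      obtain ⟨x, rfl⟩ := Φ.surjective y
      simp [he]
    · rintro ⟨A, hA⟩
      refine ⟨e ⁻¹' A, ?_⟩
      ext x
      rw [Set.mem_preimage, Set.mem_preimage, ← he, ← Set.mem_preimage (f := p'), ← hA]
      simp

/-- Two S_MC-approximations G=(U,W,T,S) and G'=(U',W',T',S') with
|U| = |U'| and |W| = |W'| have homeomorphic associated topologies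
τ = { Ḡ(A) : A ⊆ W } and τ' = { Ḡ'(A') : A' ⊆ W' } if and only if |W_i| = |W'_i| for
every non-negative integer i, where W_i = {w ∈ W : deg_G(w) = i} and
deg_G(w) = |{u ∈ U : the atom of S(T(u), ·) is {w}}|. -/
theorem smc_topologies_homeomorphic_iff {U W U' W' : Type*}
    [Fintype U] [Fintype W] [Nonempty U] [Nonempty W]
    [Fintype U'] [Fintype W'] [Nonempty U'] [Nonempty W']
    (T : U → Set W) (hT : ∀ x, (T x).Nonempty)
    (S : Set W → Set W → Bool)
    (hmin : ∀ A B C : Set W, A.Nonempty → S A (B ∩ C) = (S A B && S A C))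
    (hcomp : ∀ A B : Set W, A.Nonempty → S A Bᶜ = !(S A B))
    (hempty : ∀ A : Set W, A.Nonempty → S A ∅ = false)
    (T' : U' → Set W') (hT' : ∀ x, (T' x).Nonempty)
    (S' : Set W' → Set W' → Bool)
    (hmin' : ∀ A B C : Set W', A.Nonempty → S' A (B ∩ C) = (S' A B && S' A C))
    (hcomp' : ∀ A B : Set W', A.Nonempty → S' A Bᶜ = !(S' A B))
    (hempty' : ∀ A : Set W', A.Nonempty → S' A ∅ = false)
    (hU : Fintype.card U = Fintype.card U') (hW : Fintype.card W = Fintype.card W') :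
    (∃ Φ : U ≃ U', ∀ Y : Set U,
        Y ∈ {Z : Set U | ∃ A : Set W, Z = {x : U | S (T x) Aᶜ = false}} ↔
          Φ '' Y ∈ {Z : Set U' | ∃ A' : Set W', Z = {x : U' | S' (T' x) A'ᶜ = false}}) ↔
      (∀ i : ℕ,
        Set.ncard {w : W |
            Set.ncard {u : U | MinAtom (fun B => S (T u) B) {w}} = i} =
          Set.ncard {w' : W' |
            Set.ncard {u : U' | MinAtom (fun B => S' (T' u) B) {w'}} = i}) := by
  choose p hp using fun u => smc_point (S (T u)) (fun B C => hmin _ B C (hT u))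
    (fun B => hcomp _ B (hT u)) (hempty _ (hT u))
  choose p' hp' using fun u => smc_point (S' (T' u)) (fun B C => hmin' _ B C (hT' u))
    (fun B => hcomp' _ B (hT' u)) (hempty' _ (hT' u))
  have e1 : ∀ A : Set W, {x : U | S (T x) Aᶜ = false} = p ⁻¹' A := by
    intro A
    ext x
    simp [hcomp _ A (hT x), hp]
  have e2 : ∀ A : Set W', {x : U' | S' (T' x) Aᶜ = false} = p' ⁻¹' A := by
    intro A
    ext x
    simp [hcomp' _ A (hT' x), hp']
  have a1 : ∀ u w, MinAtom (fun B => S (T u) B) {w} ↔ p u = w := fun u w =>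
    smc_atom _ _ (hp u) w
  have a2 : ∀ u w, MinAtom (fun B => S' (T' u) B) {w} ↔ p' u = w := fun u w =>
    smc_atom _ _ (hp' u) w
  simp only [e1, e2, a1, a2, Set.mem_setOf_eq]
  exact smc_core hW p p'
end

section
/- Fix positive integers m and n, and let T_{m,n} denote the collection of all S_MC-approximations G=(U,W,T,S) with |U| = m and |W| = n, each equipped with its associated topology τ_G = { Ḡ(A) : A ⊆ W } on U. Then the number of equivalence classes of the topologies (U, τ_G), G ∈ T_{m,n}, under homeomorphism equals p(m,n), the number of unordered partitions of m into at most n positive integer summands. -/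
/-- An S_MC-approximation with universes of cardinalities `m` and `n`,
realized on `Fin m` and `Fin n`. -/
structure SMCApprox (m n : ℕ) where
  T : Fin m → Set (Fin n)
  hT : ∀ x, (T x).Nonempty
  S : Set (Fin n) → Set (Fin n) → Bool
  hmin : ∀ A B C : Set (Fin n), A.Nonempty → S A (B ∩ C) = (S A B && S A C)
  hcomp : ∀ A B : Set (Fin n), A.Nonempty → S A Bᶜ = !(S A B)
  hempty : ∀ A : Set (Fin n), A.Nonempty → S A ∅ = false

/-- The topology associated with an S_MC-approximation: the family of upper
approximations Ḡ(A) of all subsets A of the second universe. -/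
def SMCApprox.tau {m n : ℕ} (G : SMCApprox m n) : Set (Set (Fin m)) :=
  {Y | ∃ A : Set (Fin n), Y = {x : Fin m | G.S (G.T x) Aᶜ = false}}

/-- Homeomorphism of the topologies associated with two S_MC-approximations: a bijection
of the underlying universes carrying open sets to open sets in both directions. -/
def SMCApprox.Homeo {m n : ℕ} (G G' : SMCApprox m n) : Prop :=
  ∃ Φ : Fin m ≃ Fin m, ∀ Y : Set (Fin m), Y ∈ G.tau ↔ Φ '' Y ∈ G'.tau

namespace SMCAux
open Finset

lemma exists_pt {m n : ℕ} (G : SMCApprox m n) (A : Set (Fin n)) (hA : A.Nonempty) :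
    ∃ w : Fin n, ∀ B : Set (Fin n), G.S A B = true ↔ w ∈ B := by
  have hex : ∃ w : Fin n, G.S A {w} = true := by
    by_contra hcon
    push Not at hcon
    have key : ∀ F : Finset (Fin n), G.S A ((F : Set (Fin n))ᶜ) = true := by
      intro F
      induction F using Finset.induction_on with
      | empty => rw [G.hcomp A _ hA]; simp [G.hempty A hA]
      | insert a s has ih =>
        have : (((insert a s : Finset (Fin n)) : Set (Fin n))ᶜ) = {a}ᶜ ∩ (s : Set (Fin n))ᶜ := by
          ext x; simp
        rw [this, G.hmin A _ _ hA, ih, G.hcomp A _ hA]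
        have := hcon a
        simp at this
        simp [this]
    have := key Finset.univ
    simp [G.hempty A hA] at this
  obtain ⟨w, hw⟩ := hex
  have h1 : ∀ B : Set (Fin n), w ∈ B → G.S A B = true := by
    intro B hB
    have h := G.hmin A {w} B hA
    rw [Set.inter_eq_left.mpr (by simpa using hB), hw] at h
    simpa using h.symm
  refine ⟨w, fun B => ⟨fun h => ?_, h1 B⟩⟩
  by_contra hB
  have h2 := h1 Bᶜ hB
  rw [G.hcomp A _ hA, h] at h2
  simp at h2

noncomputable def pt {m n : ℕ} (G : SMCApprox m n) (x : Fin m) : Fin n :=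
  (exists_pt G (G.T x) (G.hT x)).choose

lemma tau_iff {m n : ℕ} (G : SMCApprox m n) (Y : Set (Fin m)) :
    Y ∈ G.tau ↔ ∃ A : Set (Fin n), Y = pt G ⁻¹' A := by
  have : ∀ A : Set (Fin n), {x : Fin m | G.S (G.T x) Aᶜ = false} = pt G ⁻¹' A := by
    intro A
    ext x
    have h := (exists_pt G (G.T x) (G.hT x)).choose_spec A
    simp only [Set.mem_ofPred_eq, Set.mem_preimage, pt]
    rw [← h, G.hcomp _ _ (G.hT x)]
    simp
  simp only [SMCApprox.tau, Set.mem_ofPred_eq, this]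

lemma exists_G {m n : ℕ} (w : Fin m → Fin n) : ∃ G : SMCApprox m n, pt G = w := by
  classical
  let S : Set (Fin n) → Set (Fin n) → Bool := fun A B =>
    decide (∃ h : A.Nonempty, h.some ∈ B)
  let G : SMCApprox m n :=
    { T := fun x => {w x}
      hT := fun x => Set.singleton_nonempty _
      S := S
      hmin := by intro A B C h; simp [S, h]
      hcomp := by intro A B h; simp [S, h]
      hempty := by intro A h; simp [S] }
  refine ⟨G, ?_⟩
  funext x
  have h := ((exists_pt G (G.T x) (G.hT x)).choose_spec {w x}).1 (by
    have hne : ({w x} : Set (Fin n)).Nonempty := Set.singleton_nonempty _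
    have hh : S {w x} {w x} = true := by
      have h0 : ∀ A B : Set (Fin n), (∃ h : A.Nonempty, h.some ∈ B) → S A B = true :=
        fun A B h => decide_eq_true h
      exact h0 _ _ ⟨hne, hne.some_mem⟩
    exact hh)
  exact h

def fib {m n : ℕ} (w : Fin m → Fin n) (j : Fin n) : ℕ := #{x | w x = j}

def ms {m n : ℕ} (w : Fin m → Fin n) : Multiset ℕ := (univ : Finset (Fin n)).val.map (fib w)

lemma ms_sum {m n : ℕ} (w : Fin m → Fin n) : (ms w).sum = m := by
  have := Finset.card_eq_sum_card_fiberwise (f := w) (s := univ) (t := univ) (by simp)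
  simp only [card_univ, Fintype.card_fin] at this
  exact this.symm

lemma ms_card {m n : ℕ} (w : Fin m → Fin n) : (ms w).card = n := by simp [ms]

def part {m n : ℕ} (w : Fin m → Fin n) : Nat.Partition m := Nat.Partition.ofSums m (ms w) (ms_sum w)

lemma part_parts {m n : ℕ} (w : Fin m → Fin n) : (part w).parts = (ms w).filter (· ≠ 0) := rfl

lemma part_card {m n : ℕ} (w : Fin m → Fin n) : (part w).parts.card ≤ n := by
  rw [part_parts]
  exact (Multiset.card_le_card (Multiset.filter_le _ _)).trans (ms_card w).le

lemma eq_pad (s : Multiset ℕ) : s = s.filter (· ≠ 0) +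
    Multiset.replicate (s.card - (s.filter (· ≠ 0)).card) 0 := by
  have h := Multiset.filter_add_not (· ≠ 0) s
  have h2 : s.filter (fun a => ¬ (a ≠ 0)) =
      Multiset.replicate (s.card - (s.filter (· ≠ 0)).card) 0 := by
    rw [Multiset.eq_replicate]
    constructor
    · have := congrArg Multiset.card h
      rw [Multiset.card_add] at this
      omega
    · intro b hb
      simpa using (Multiset.mem_filter.1 hb).2
  rw [← h2, h]

lemma part_eq_iff {m n : ℕ} (w w' : Fin m → Fin n) : part w = part w' ↔ ms w = ms w' := by
  constructor
  · intro h
    have h2 := congrArg Nat.Partition.parts h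
    rw [part_parts, part_parts] at h2
    rw [eq_pad (ms w), eq_pad (ms w'), ms_card, ms_card, h2]
  · intro h
    apply Nat.Partition.ext
    rw [part_parts, part_parts, h]

lemma map_univ_iff {n : ℕ} (f g : Fin n → ℕ) :
    (univ : Finset (Fin n)).val.map f = (univ : Finset (Fin n)).val.map g ↔
      ∃ σ : Fin n ≃ Fin n, f = g ∘ σ := by
  constructor
  · intro h
    have e : ∀ k, Nonempty ({x // f x = k} ≃ {x // g x = k}) := by
      intro k
      refine ⟨Fintype.equivOfCardEq ?_⟩
      have := congrArg (Multiset.count k) h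
      rw [Multiset.count_map, Multiset.count_map] at this
      rw [Fintype.card_subtype, Fintype.card_subtype]
      simp only [eq_comm (a := k)] at this
      exact this
    replace e := fun k => (e k).some
    refine ⟨(Equiv.sigmaFiberEquiv f).symm.trans
      ((Equiv.sigmaCongrRight e).trans (Equiv.sigmaFiberEquiv g)), ?_⟩
    funext x
    exact (e (f x) ⟨x, rfl⟩).2.symm
  · rintro ⟨σ, rfl⟩
    rw [← Multiset.map_map, Multiset.map_univ_val_equiv]

lemma ms_eq_iff {m n : ℕ} (w w' : Fin m → Fin n) :
    ms w = ms w' ↔ ∃ (Φ : Fin m ≃ Fin m) (σ : Fin n ≃ Fin n), ∀ x, w' (Φ x) = σ (w x) := by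
  constructor
  · intro h
    obtain ⟨σ, hσ⟩ : ∃ σ : Fin n ≃ Fin n, fib w = fib w' ∘ σ := by
      exact map_univ_iff _ _ |>.1 h
    have e : ∀ j, Nonempty ({x // w x = j} ≃ {x // w' x = σ j}) := by
      intro j
      refine ⟨Fintype.equivOfCardEq ?_⟩
      have := congrFun hσ j
      simp only [fib, Function.comp] at this
      rw [Fintype.card_subtype, Fintype.card_subtype, this]
    replace e := fun j => (e j).some
    let E : (Σ j, {x // w x = j}) ≃ (Σ j, {x // w' x = j}) := Equiv.sigmaCongr σ e
    refine ⟨(Equiv.sigmaFiberEquiv w).symm.trans (E.trans (Equiv.sigmaFiberEquiv w')), σ, ?_⟩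
    intro x
    exact (e (w x) ⟨x, rfl⟩).2
  · rintro ⟨Φ, σ, h⟩
    refine map_univ_iff _ _ |>.2 ⟨σ, ?_⟩
    funext j
    simp only [fib, Function.comp]
    refine Finset.card_bij (fun x _ => Φ x) ?_ ?_ ?_
    · intro x hx; simp at hx; simp [h, hx]
    · intro x _ y _ hxy; exact Φ.injective hxy
    · intro y hy
      refine ⟨Φ.symm y, ?_, by simp⟩
      simp at hy
      have := h (Φ.symm y)
      simp [hy] at this
      simp [this]

lemma exists_sigma {m n : ℕ} (w w' : Fin m → Fin n) (Φ : Fin m ≃ Fin m)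
    (h : ∀ x y, w x = w y ↔ w' (Φ x) = w' (Φ y)) :
    ∃ σ : Fin n ≃ Fin n, ∀ x, w' (Φ x) = σ (w x) := by
  classical
  let f : {j // j ∈ Set.range w} → {j // j ∈ Set.range w'} := fun j => ⟨w' (Φ j.2.choose), ⟨_, rfl⟩⟩
  have hf : ∀ x, (f ⟨w x, ⟨x, rfl⟩⟩ : Fin n) = w' (Φ x) := by
    intro x
    have : w (Exists.choose (⟨x, rfl⟩ : ∃ y, w y = w x)) = w x :=
      Exists.choose_spec (⟨x, rfl⟩ : ∃ y, w y = w x)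
    exact (h _ _).1 this
  have hb : Function.Bijective f := by
    constructor
    · rintro ⟨_, x, rfl⟩ ⟨_, y, rfl⟩ hxy
      have := congrArg Subtype.val hxy
      rw [hf, hf] at this
      exact Subtype.ext ((h _ _).2 this)
    · rintro ⟨_, y, rfl⟩
      refine ⟨⟨w (Φ.symm y), ⟨_, rfl⟩⟩, Subtype.ext ?_⟩
      rw [hf]; simp
  refine ⟨(Equiv.ofBijective f hb).extendSubtype, fun x => ?_⟩
  rw [Equiv.extendSubtype_apply_of_mem _ _ ⟨x, rfl⟩]
  exact (hf x).symm

lemma homeo_iff {m n : ℕ} (G G' : SMCApprox m n) :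
    G.Homeo G' ↔ part (pt G) = part (pt G') := by
  rw [part_eq_iff, ms_eq_iff]
  constructor
  · rintro ⟨Φ, h⟩
    refine ⟨Φ, exists_sigma _ _ Φ ?_⟩
    intro x y
    constructor
    · intro hxy
      have h1 := (h (Φ ⁻¹' (pt G' ⁻¹' {pt G' (Φ x)}))).2 (by
        rw [Set.image_preimage_eq _ Φ.surjective, tau_iff]; exact ⟨_, rfl⟩)
      rw [tau_iff] at h1
      obtain ⟨A, hA⟩ := h1
      have hx : x ∈ pt G ⁻¹' A := by rw [← hA]; simp
      have hy : y ∈ pt G ⁻¹' A := by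
        simp only [Set.mem_preimage] at hx ⊢; rwa [← hxy]
      rw [← hA] at hy
      simpa using hy.symm
    · intro hxy
      have h1 := (h (pt G ⁻¹' {pt G x})).1 (by rw [tau_iff]; exact ⟨_, rfl⟩)
      rw [tau_iff] at h1
      obtain ⟨A, hA⟩ := h1
      have hx : Φ x ∈ pt G' ⁻¹' A := by rw [← hA]; exact ⟨x, by simp, rfl⟩
      have hy : Φ y ∈ pt G' ⁻¹' A := by
        simp only [Set.mem_preimage] at hx ⊢; rwa [← hxy]
      rw [← hA] at hy
      obtain ⟨z, hz, hzy⟩ := hy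
      rw [Φ.injective hzy] at hz
      exact hz.symm
  · rintro ⟨Φ, σ, h⟩
    refine ⟨Φ, fun Y => ?_⟩
    rw [tau_iff, tau_iff]
    constructor
    · rintro ⟨A, rfl⟩
      refine ⟨σ '' A, ?_⟩
      ext y
      obtain ⟨x, rfl⟩ := Φ.surjective y
      simp [h]
    · rintro ⟨A, hA⟩
      refine ⟨σ ⁻¹' A, ?_⟩
      ext x
      have : Φ x ∈ Φ '' Y ↔ Φ x ∈ pt G' ⁻¹' A := by rw [hA]
      simpa [h] using this

lemma part_surj {m n : ℕ} (p : Nat.Partition m) (hp : p.parts.card ≤ n) :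
    ∃ w : Fin m → Fin n, part w = p := by
  let s := p.parts + Multiset.replicate (n - p.parts.card) 0
  have hs : s.card = n := by simp [s]; omega
  have hsum : s.sum = m := by simp [s, p.parts_sum]
  obtain ⟨f, hf⟩ : ∃ f : Fin n → ℕ, (univ : Finset (Fin n)).val.map f = s := by
    clear_value s
    induction s using Quotient.inductionOn with
    | h l =>
      have hl : l.length = n := by simpa using hs
      subst hl
      refine ⟨l.get, ?_⟩
      simp [Fin.univ_val_map]
  have hc : Fintype.card (Σ j, Fin (f j)) = Fintype.card (Fin m) := by
    simp only [Fintype.card_sigma, Fintype.card_fin]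
    rw [← hsum, ← hf]; rfl
  let e := Fintype.equivOfCardEq hc
  refine ⟨fun x => (e.symm x).1, ?_⟩
  have hfib : fib (fun x => (e.symm x).1) = f := by
    funext j
    have : #{x | (e.symm x).1 = j} = Fintype.card (Fin (f j)) := by
      rw [← Fintype.card_subtype]
      refine Fintype.card_congr ?_
      exact (e.symm.subtypeEquiv (fun _ => Iff.rfl)).trans (Equiv.sigmaSubtype j)
    simpa [fib] using this
  apply Nat.Partition.ext
  rw [part_parts, ms, hfib, hf]
  simp only [s, Multiset.filter_add]
  rw [Multiset.filter_eq_self.2 (fun a ha => (p.parts_pos ha).ne'),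
    Multiset.filter_eq_nil.2 (fun a ha => by simp [Multiset.eq_of_mem_replicate ha])]
  simp

end SMCAux

theorem card_smc_topologies_up_to_homeo (m n : ℕ) (hm : 0 < m) (hn : 0 < n) :
    Nat.card (Quot (SMCApprox.Homeo (m := m) (n := n))) =
      Nat.card {p : Nat.Partition m // p.parts.card ≤ n} := by
  refine Nat.card_eq_of_bijective
    (Quot.lift (fun G => ⟨SMCAux.part (SMCAux.pt G), SMCAux.part_card _⟩)
      (fun G G' h => Subtype.ext ((SMCAux.homeo_iff G G').1 h))) ⟨?_, ?_⟩
  · rintro ⟨G⟩ ⟨G'⟩ h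
    exact Quot.sound ((SMCAux.homeo_iff G G').2 (congrArg Subtype.val h))
  · rintro ⟨p, hp⟩
    obtain ⟨w, hw⟩ := SMCAux.part_surj p hp
    obtain ⟨G, hG⟩ := SMCAux.exists_G w
    refine ⟨Quot.mk _ G, Subtype.ext ?_⟩
    change SMCAux.part (SMCAux.pt G) = p
    rw [hG, hw]
end
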